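/- arXiv:2010.11002 — 2 statements merged into one kernel-verified Lean document; each statement's English description precedes it below -/
import Mathlib

section
/- Under weak overlap, taking h(k,s,a) = 1/π_*(a|s) whenever π^e(a|s) > 0 (and, say, h(k,s,a) so that (*) holds elsewhere, e.g. h = 1/π_* wherever π_* > 0) and g = q, the estimator Γ(D; 1/π_*, q) satisfies the constraint (*) and attains the lower bound exactly: var[Γ(D; 1/π_*, q)] = V*/n, where V* = E_{π_*}[(π^e(a|s)/π_*(a|s))² σ_r²(s,a)] + var_{p_S}[v(s)]. -/
open MeasureTheory ProbabilityTheory BigOperators Filter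
open scoped NNReal ENNReal

noncomputable section

/-- Joint law of an observation `(s, a, r)` when contexts are drawn from `pS`, actions
from the policy `π`, and rewards from the reward kernel `pR`. -/
def obsMeasure {S A : Type*} [MeasurableSpace S] [MeasurableSpace A] [Fintype A]
    (pS : Measure S) (π : S → A → ℝ) (pR : S → A → Measure ℝ) :
    Measure (S × A × ℝ) :=
  pS.bind fun s => ∑ a : A, ENNReal.ofReal (π s a) • (pR s a).map (fun r => (s, a, r))


/-- The sampling law of `(s,a,r)` given `s`, as a measurable map into measures. -/
lemma obs_meas {S A : Type*} [MeasurableSpace S] [MeasurableSpace A] [Fintype A]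
    [MeasurableSingletonClass A]
    (pR : S → A → Measure ℝ) (hRprob : ∀ s a, IsProbabilityMeasure (pR s a))
    (hRmeas : Measurable fun p : S × A => pR p.1 p.2)
    (π : S → A → ℝ) (hπ : ∀ a, Measurable fun s => π s a) :
    Measurable (fun s => ∑ a : A, ENNReal.ofReal (π s a) •
      (pR s a).map (fun r => (s, a, r))) := by
  refine Measure.measurable_of_measurable_coe _ fun B hB => ?_
  simp only [Measure.coe_finsetSum, Finset.sum_apply, Measure.smul_apply, smul_eq_mul]
  refine Finset.measurable_sum _ fun a _ => (hπ a).ennreal_ofReal.mul ?_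
  let κ : Kernel S ℝ := ⟨fun s => pR s a, hRmeas.comp (measurable_id.prodMk measurable_const)⟩
  have : IsMarkovKernel κ := ⟨fun s => hRprob s a⟩
  have h2 : MeasurableSet ((fun p : S × ℝ => (p.1, a, p.2)) ⁻¹' B) :=
    (by fun_prop : Measurable (fun p : S × ℝ => (p.1, a, p.2))) hB
  have := Kernel.measurable_kernel_prodMk_left (κ := κ) h2
  convert this using 2 with s
  rw [Measure.map_apply (by fun_prop) hB]
  rfl

lemma obs_prob {S A : Type*} [MeasurableSpace S] [MeasurableSpace A] [Fintype A]
    [MeasurableSingletonClass A] (pS : Measure S) [IsProbabilityMeasure pS]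
    (pR : S → A → Measure ℝ) (hRprob : ∀ s a, IsProbabilityMeasure (pR s a))
    (hRmeas : Measurable fun p : S × A => pR p.1 p.2)
    (π : S → A → ℝ) (hπ : ∀ a, Measurable fun s => π s a)
    (hnn : ∀ s a, 0 ≤ π s a) (hsum : ∀ s, ∑ a, π s a = 1) :
    IsProbabilityMeasure (obsMeasure pS π pR) := by
  constructor
  rw [obsMeasure, Measure.bind_apply .univ (obs_meas pR hRprob hRmeas π hπ).aemeasurable]
  have : ∀ s, (∑ a : A, ENNReal.ofReal (π s a) •
      (pR s a).map (fun r => (s, a, r))) Set.univ = 1 := by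
    intro s
    simp only [Measure.coe_finsetSum, Finset.sum_apply, Measure.smul_apply, smul_eq_mul]
    have : ∀ a, ((pR s a).map (fun r => (s, a, r))) Set.univ = 1 := by
      intro a
      rw [Measure.map_apply (by fun_prop) .univ]
      simp
    simp only [this, mul_one]
    rw [← ENNReal.ofReal_sum_of_nonneg (fun a _ => hnn s a), hsum, ENNReal.ofReal_one]
  simp [this]

lemma obs_ae {S A : Type*} [MeasurableSpace S] [MeasurableSpace A] [Fintype A]
    [MeasurableSingletonClass A] (pS : Measure S) [IsProbabilityMeasure pS]
    (pR : S → A → Measure ℝ) (hRprob : ∀ s a, IsProbabilityMeasure (pR s a))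
    (hRmeas : Measurable fun p : S × A => pR p.1 p.2)
    (π : S → A → ℝ) (hπ : ∀ a, Measurable fun s => π s a)
    (P : S × A × ℝ → Prop) (hP : MeasurableSet {x | P x})
    (h : ∀ s a, ∀ᵐ r ∂pR s a, P (s, a, r)) :
    ∀ᵐ x ∂obsMeasure pS π pR, P x := by
  change obsMeasure pS π pR {x | P x}ᶜ = 0
  rw [obsMeasure,
    Measure.bind_apply hP.compl (obs_meas pR hRprob hRmeas π hπ).aemeasurable]
  have : ∀ s, (∑ a : A, ENNReal.ofReal (π s a) •
      (pR s a).map (fun r => (s, a, r))) {x | P x}ᶜ = 0 := by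
    intro s
    simp only [Measure.coe_finsetSum, Finset.sum_apply, Measure.smul_apply, smul_eq_mul]
    refine Finset.sum_eq_zero fun a _ => ?_
    rw [Measure.map_apply (by fun_prop) hP.compl]
    have := h s a
    rw [ae_iff] at this
    exact mul_eq_zero_of_right _ this
  simp [this]

lemma obs_integral {S A : Type*} [MeasurableSpace S] [MeasurableSpace A] [Fintype A]
    [MeasurableSingletonClass A] (pS : Measure S) [IsProbabilityMeasure pS]
    (pR : S → A → Measure ℝ) (hRprob : ∀ s a, IsProbabilityMeasure (pR s a))
    (hRmeas : Measurable fun p : S × A => pR p.1 p.2)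
    (π : S → A → ℝ) (hπ : ∀ a, Measurable fun s => π s a)
    (hnn : ∀ s a, 0 ≤ π s a) (hsum : ∀ s, ∑ a, π s a = 1)
    (f : S × A × ℝ → ℝ) (hf : Measurable f) (C : ℝ)
    (hC : ∀ s a, ∀ᵐ r ∂pR s a, |f (s, a, r)| ≤ C) :
    ∫ x, f x ∂obsMeasure pS π pR = ∫ s, ∑ a, π s a * ∫ r, f (s, a, r) ∂pR s a ∂pS := by
  have := obs_prob pS pR hRprob hRmeas π hπ hnn hsum
  have hint : Integrable f (obsMeasure pS π pR) := by
    refine Integrable.of_bound hf.aestronglyMeasurable C ?_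
    exact obs_ae pS pR hRprob hRmeas π hπ _ (measurableSet_le hf.norm measurable_const) hC
  let κ : Kernel S (S × A × ℝ) := ⟨_, obs_meas pR hRprob hRmeas π hπ⟩
  have he : obsMeasure pS π pR = (κ ∘ₖ Kernel.const Unit pS) () := by
    rw [Kernel.comp_apply]; rfl
  rw [he] at hint ⊢
  rw [Kernel.integral_comp hint]
  simp only [Kernel.const_apply]
  congr 1
  ext s
  change ∫ y, f y ∂(∑ a : A, ENNReal.ofReal (π s a) • (pR s a).map (fun r => (s, a, r))) = _
  rw [integral_finsetSum_measure]
  · refine Finset.sum_congr rfl fun a _ => ?_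
    rw [integral_smul_measure, integral_map (by fun_prop) hf.aestronglyMeasurable,
      ENNReal.toReal_ofReal (hnn s a), smul_eq_mul]
  · intro a _
    refine Integrable.smul_measure ?_ ENNReal.ofReal_ne_top
    rw [integrable_map_measure hf.aestronglyMeasurable (by fun_prop)]
    have := hRprob s a
    exact Integrable.of_bound (hf.comp (by fun_prop)).aestronglyMeasurable C (hC s a)

lemma inner_facts (μ : Measure ℝ) [IsProbabilityMeasure μ] (M : ℝ)
    (hb : ∀ᵐ r ∂μ, r ∈ Set.Icc (0 : ℝ) M) (m V : ℝ) (hm : m = ∫ r, r ∂μ)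
    (hV : V = variance id μ) (w c : ℝ) :
    (0 ≤ M ∧ 0 ≤ m ∧ m ≤ M ∧ 0 ≤ V ∧ V ≤ M ^ 2 ∧ V = ∫ r, r ^ 2 ∂μ - m ^ 2) ∧
    ∫ r, (w * (r - m) + c) ∂μ = c ∧ ∫ r, (w * (r - m) + c) ^ 2 ∂μ = w ^ 2 * V + c ^ 2 := by
  have hint : Integrable (fun r : ℝ => r) μ := by
    refine Integrable.of_bound measurable_id.aestronglyMeasurable M ?_
    filter_upwards [hb] with r hr
    rw [Real.norm_eq_abs, abs_of_nonneg hr.1]; exact hr.2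
  have hint2 : Integrable (fun r : ℝ => r ^ 2) μ := by
    refine Integrable.of_bound (measurable_id.pow_const 2).aestronglyMeasurable (M ^ 2) ?_
    filter_upwards [hb] with r hr
    rw [Real.norm_eq_abs, abs_of_nonneg (sq_nonneg r)]
    exact pow_le_pow_left₀ hr.1 hr.2 2
  have hm0 : 0 ≤ m := by
    rw [hm]; exact integral_nonneg_of_ae (by filter_upwards [hb] with r hr using hr.1)
  have hmM : m ≤ M := by
    rw [hm]
    calc ∫ r, r ∂μ ≤ ∫ _, M ∂μ := integral_mono_ae hint (integrable_const M)
          (by filter_upwards [hb] with r hr using hr.2)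
      _ = M := by simp
  have h2M : ∫ r, r ^ 2 ∂μ ≤ M ^ 2 := by
    calc ∫ r, r ^ 2 ∂μ ≤ ∫ _, M ^ 2 ∂μ := integral_mono_ae hint2 (integrable_const _)
          (by filter_upwards [hb] with r hr using pow_le_pow_left₀ hr.1 hr.2 2)
      _ = M ^ 2 := by simp
  have hquad : ∀ a b d : ℝ, ∫ r, (a * r ^ 2 + b * r + d) ∂μ
      = a * ∫ r, r ^ 2 ∂μ + b * m + d := by
    intro a b d
    have h1 : Integrable (fun r : ℝ => a * r ^ 2 + b * r) μ :=
      (hint2.const_mul a).add (hint.const_mul b)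
    rw [integral_add h1 (integrable_const _),
      integral_add (hint2.const_mul _) (hint.const_mul _), integral_const_mul,
      integral_const_mul, ← hm]
    simp
  have hVeq : V = ∫ r, r ^ 2 ∂μ - m ^ 2 := by
    rw [hV, variance_eq_integral measurable_id.aemeasurable]
    simp only [id, ← hm]
    have : ∀ r : ℝ, (r - m) ^ 2 = 1 * r ^ 2 + (- 2 * m) * r + m ^ 2 := fun r => by ring
    simp only [this]
    rw [hquad]
    ring
  refine ⟨⟨hm0.trans hmM, hm0, hmM, hV ▸ variance_nonneg _ _, ?_, hVeq⟩, ?_, ?_⟩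
  · nlinarith
  · have : ∀ r : ℝ, w * (r - m) + c = 0 * r ^ 2 + w * r + (c - w * m) := fun r => by ring
    simp only [this]
    rw [hquad]
    ring
  · have : ∀ r : ℝ, (w * (r - m) + c) ^ 2 =
        w ^ 2 * r ^ 2 + (2 * w * c - 2 * w ^ 2 * m) * r + (c - w * m) ^ 2 := fun r => by ring
    simp only [this]
    rw [hquad, hVeq]
    ring

lemma term_integrable {S A : Type*} [MeasurableSpace S] [Fintype A]
    (pS : Measure S) [IsProbabilityMeasure pS]
    (π : S → A → ℝ) (hπ : ∀ a, Measurable fun s => π s a)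
    (hnn : ∀ s a, 0 ≤ π s a) (hsum : ∀ s, ∑ a, π s a = 1)
    (F : S → A → ℝ) (hF : ∀ a, Measurable fun s => F s a) (C : ℝ) (hC : ∀ s a, |F s a| ≤ C) :
    Integrable (fun s => ∑ a, π s a * F s a) pS := by
  refine integrable_finsetSum _ fun a _ => ?_
  refine Integrable.of_bound ((hπ a).mul (hF a)).aestronglyMeasurable C ?_
  refine ae_of_all _ fun s => ?_
  have h1 : π s a ≤ 1 := by
    rw [← hsum s]
    exact Finset.single_le_sum (f := fun a => π s a) (fun b _ => hnn s b) (Finset.mem_univ a)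
  rw [Real.norm_eq_abs, abs_mul, abs_of_nonneg (hnn s a)]
  nlinarith [hC s a, hnn s a, abs_nonneg (F s a)]

lemma single_var {S A : Type*} [MeasurableSpace S] [MeasurableSpace A] [Fintype A]
    [MeasurableSingletonClass A] (pS : Measure S) [IsProbabilityMeasure pS]
    (pR : S → A → Measure ℝ) (hRprob : ∀ s a, IsProbabilityMeasure (pR s a))
    (hRmeas : Measurable fun p : S × A => pR p.1 p.2)
    (M : ℝ) (hb : ∀ s a, ∀ᵐ r ∂ pR s a, r ∈ Set.Icc (0 : ℝ) M)
    (π : S → A → ℝ) (hπ : ∀ a, Measurable fun s => π s a)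
    (hnn : ∀ s a, 0 ≤ π s a) (hsum : ∀ s, ∑ a, π s a = 1)
    (q σ2 W : S → A → ℝ) (v : S → ℝ) (hq : ∀ s a, q s a = ∫ r, r ∂ pR s a)
    (hσ2 : ∀ s a, σ2 s a = variance id (pR s a))
    (hqm : ∀ a, Measurable fun s => q s a) (hσm : ∀ a, Measurable fun s => σ2 s a)
    (hWm : ∀ a, Measurable fun s => W s a) (hvm : Measurable v)
    (B : ℝ) (hW : ∀ s a, |W s a| ≤ B) (hvb : ∀ s, |v s| ≤ M) :
    MemLp (fun x : S × A × ℝ => W x.1 x.2.1 * (x.2.2 - q x.1 x.2.1) + v x.1) 2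
      (obsMeasure pS π pR) ∧
    variance (fun x : S × A × ℝ => W x.1 x.2.1 * (x.2.2 - q x.1 x.2.1) + v x.1)
      (obsMeasure pS π pR) =
    ∫ s, ∑ a, π s a * (W s a ^ 2 * σ2 s a) ∂pS + variance v pS := by
  have := obs_prob pS pR hRprob hRmeas π hπ hnn hsum
  have lift : ∀ F : S → A → ℝ, (∀ a, Measurable fun s => F s a) →
      Measurable (fun x : S × A × ℝ => F x.1 x.2.1) := by
    intro F hF
    have : Measurable (fun p : S × A => F p.1 p.2) := measurable_from_prod_countable_left hF
    exact this.comp (measurable_fst.prodMk measurable_snd.fst)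
  set X : S × A × ℝ → ℝ := fun x => W x.1 x.2.1 * (x.2.2 - q x.1 x.2.1) + v x.1 with hX
  have hXm : Measurable X :=
    ((lift W hWm).mul (measurable_snd.snd.sub (lift q hqm))).add (hvm.comp measurable_fst)
  have facts := fun s a w c =>
    have := hRprob s a
    inner_facts (pR s a) M (hb s a) (q s a) (σ2 s a) (hq s a) (hσ2 s a) w c
  have hXb : ∀ s a, ∀ᵐ r ∂pR s a, |X (s, a, r)| ≤ B * M + M := by
    intro s a
    filter_upwards [hb s a] with r hr
    obtain ⟨⟨h0, h1, h2, -⟩, -⟩ := facts s a 0 0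
    have h3 : |r - q s a| ≤ M := abs_le.2 ⟨by linarith [hr.1], by linarith [hr.2]⟩
    refine (abs_add_le _ _).trans (add_le_add ?_ (hvb s))
    rw [abs_mul]
    exact mul_le_mul (hW s a) h3 (abs_nonneg _) ((abs_nonneg _).trans (hW s a))
  refine ⟨MemLp.of_bound hXm.aestronglyMeasurable (B * M + M)
    (obs_ae pS pR hRprob hRmeas π hπ _ (measurableSet_le hXm.norm measurable_const) hXb), ?_⟩
  have hmean : ∫ x, X x ∂obsMeasure pS π pR = ∫ s, v s ∂pS := by
    rw [obs_integral pS pR hRprob hRmeas π hπ hnn hsum X hXm _ hXb]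
    congr 1; ext s
    have : ∀ a, ∫ r, X (s, a, r) ∂pR s a = v s := fun a => (facts s a (W s a) (v s)).2.1
    simp only [this]
    rw [← Finset.sum_mul, hsum, one_mul]
  rw [variance_eq_integral hXm.aemeasurable, hmean, variance_eq_integral hvm.aemeasurable]
  set m := ∫ s, v s ∂pS
  rw [obs_integral pS pR hRprob hRmeas π hπ hnn hsum (fun x => (X x - m) ^ 2)
    ((hXm.sub_const m).pow_const 2) ((B * M + M + |m|) ^ 2)]
  · rw [← integral_add]
    · congr 1; ext s
      have : ∀ a, ∫ r, (X (s, a, r) - m) ^ 2 ∂pR s a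
          = W s a ^ 2 * σ2 s a + (v s - m) ^ 2 := fun a => by
        rw [← (facts s a (W s a) (v s - m)).2.2]
        congr 1; ext r; simp only [hX]; ring
      simp only [this, mul_add, Finset.sum_add_distrib]
      rw [← Finset.sum_mul, hsum, one_mul]
    · refine term_integrable pS π hπ hnn hsum _ (fun a => ((hWm a).pow_const 2).mul (hσm a))
        (B ^ 2 * M ^ 2) fun s a => ?_
      obtain ⟨⟨h0, h1, h2, h3, h4, -⟩, -⟩ := facts s a 0 0
      rw [abs_mul, abs_pow, abs_of_nonneg h3]
      exact mul_le_mul (pow_le_pow_left₀ (abs_nonneg _) (hW s a) 2) h4 h3 (by positivity)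
    · refine Integrable.of_bound ((hvm.sub_const m).pow_const 2).aestronglyMeasurable
        ((M + |m|) ^ 2) (ae_of_all _ fun s => ?_)
      rw [Real.norm_eq_abs, abs_pow]
      exact pow_le_pow_left₀ (abs_nonneg _) ((abs_sub _ _).trans (by linarith [hvb s])) 2
  · intro s a
    filter_upwards [hXb s a] with r hr
    rw [abs_pow]
    exact pow_le_pow_left₀ (abs_nonneg _) ((abs_sub _ _).trans (by linarith)) 2

lemma pi_var {ι Ω : Type*} [Fintype ι] [MeasurableSpace Ω] (μ : ι → Measure Ω)
    (hμ : ∀ i, IsProbabilityMeasure (μ i)) (X : Ω → ℝ) (c : ℝ)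
    (hX : ∀ i, MemLp X 2 (μ i)) (Γ : (ι → Ω) → ℝ) (hΓ : ∀ ω, Γ ω = c * ∑ i, X (ω i)) :
    variance Γ (Measure.pi μ) = c ^ 2 * ∑ i, variance X (μ i) := by
  have h1 : Γ = fun ω => c * (∑ i, fun ω : ι → Ω => X (ω i)) ω := by
    funext ω
    rw [hΓ, Finset.sum_apply]
  rw [h1, variance_const_mul, variance_sum_pi (X := fun _ => X) hX]

set_option maxHeartbeats 400000 in
/-- Under weak overlap (with `π_*` bounded away from `0` on
`{π^e > 0}`), the choice `h(k,s,a) = 1/π_*(a|s)` wherever `π_*(a|s) > 0` (and `0`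
elsewhere) together with `g = q` satisfies the constraint (*) and attains the lower
bound exactly: `var[Γ(D; 1/π_*, q)] = V*/n`, where
`V* = E_{π_*}[(π^e/π_*)² σ_r²(s,a)] + var_{p_S}[v(s)]`. -/
theorem stmt2 {S A : Type*} [MeasurableSpace S] [MeasurableSpace A] [Fintype A]
    [MeasurableSingletonClass A]
    (K : ℕ) (pS : Measure S) [IsProbabilityMeasure pS]
    (pR : S → A → Measure ℝ) (hRprob : ∀ s a, IsProbabilityMeasure (pR s a))
    (hRmeas : Measurable fun p : S × A => pR p.1 p.2)
    (Rmax : ℝ) (hRbdd : ∀ s a, ∀ᵐ r ∂ pR s a, r ∈ Set.Icc (0 : ℝ) Rmax)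
    (πk : Fin K → S → A → ℝ) (πe : S → A → ℝ)
    (hπkmeas : ∀ k a, Measurable fun s => πk k s a)
    (hπemeas : ∀ a, Measurable fun s => πe s a)
    (hπknn : ∀ k s a, 0 ≤ πk k s a) (hπksum : ∀ k s, ∑ a, πk k s a = 1)
    (hπenn : ∀ s a, 0 ≤ πe s a) (hπesum : ∀ s, ∑ a, πe s a = 1)
    -- stratum sizes and proportions
    (nk : Fin K → ℕ) (hn : 0 < ∑ k, nk k)
    (ρ : Fin K → ℝ) (hρ : ∀ k, ρ k = (nk k : ℝ) / (∑ k, nk k : ℕ))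
    -- marginal logging policy
    (πstar : S → A → ℝ) (hπstar : ∀ s a, πstar s a = ∑ k, ρ k * πk k s a)
    -- weak overlap, with `π_*` bounded away from zero on `{π^e > 0}`
    (hov : ∀ s a, 0 < πe s a → 0 < πstar s a)
    (δ : ℝ) (hδ : 0 < δ) (hπstarlb : ∀ s a, 0 < πe s a → δ ≤ πstar s a)
    -- true mean reward, conditional reward variance, value function
    (q : S → A → ℝ) (hq : ∀ s a, q s a = ∫ r, r ∂ pR s a)
    (σ2 : S → A → ℝ) (hσ2 : ∀ s a, σ2 s a = variance id (pR s a))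
    (v : S → ℝ) (hv : ∀ s, v s = ∑ a, πe s a * q s a)
    -- the efficiency bound `V*`
    (Vstar : ℝ)
    (hVstar : Vstar =
      (∫ x : S × A × ℝ,
          (if πe x.1 x.2.1 = 0 then 0 else πe x.1 x.2.1 / πstar x.1 x.2.1) ^ 2 *
            σ2 x.1 x.2.1
        ∂ obsMeasure pS πstar pR) + variance v pS)
    -- the weight function `1/π_*`
    (h : S → A → ℝ) (hh : ∀ s a, h s a = if 0 < πstar s a then (πstar s a)⁻¹ else 0)
    -- the estimator `Γ(D; 1/π_*, q)`
    (Γ : (((k : Fin K) × Fin (nk k)) → S × A × ℝ) → ℝ)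
    (hΓ : ∀ ω, Γ ω =
      ((∑ k, nk k : ℕ) : ℝ)⁻¹ * ∑ i : (k : Fin K) × Fin (nk k),
        (h (ω i).1 (ω i).2.1 * πe (ω i).1 (ω i).2.1 *
            ((ω i).2.2 - q (ω i).1 (ω i).2.1) +
          ∑ a, πe (ω i).1 a * q (ω i).1 a)) :
    -- the constraint (*) holds
    (∀ s a, 0 < πe s a → ∑ k, ρ k * πk k s a * h s a = 1) ∧
    -- and the bound is attained exactly
    variance Γ
        (Measure.pi (fun i : (k : Fin K) × Fin (nk k) => obsMeasure pS (πk i.1) pR)) =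
      Vstar / (∑ k, nk k : ℕ) := by
  have hN : (0 : ℝ) < ((∑ k, nk k : ℕ) : ℝ) := by exact_mod_cast hn
  set N : ℝ := ((∑ k, nk k : ℕ) : ℝ) with hNdef
  refine ⟨?_, ?_⟩
  · intro s a ha
    have h1 := hov s a ha
    rw [← Finset.sum_mul, ← hπstar, hh, if_pos h1, mul_inv_cancel₀ h1.ne']
  have hρnn : ∀ k, 0 ≤ ρ k := fun k => by rw [hρ]; positivity
  have hρsum : ∑ k, ρ k = 1 := by
    simp only [hρ]
    rw [← Finset.sum_div, hNdef, Nat.cast_sum, div_self]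
    rw [← Nat.cast_sum]; exact hN.ne'
  have hsm : ∀ a, Measurable fun s => πstar s a := fun a => by
    simp only [hπstar]
    exact Finset.measurable_sum _ fun k _ => (hπkmeas k a).const_mul _
  have hsnn : ∀ s a, 0 ≤ πstar s a := fun s a => by
    rw [hπstar]; exact Finset.sum_nonneg fun k _ => mul_nonneg (hρnn k) (hπknn k s a)
  have hssum : ∀ s, ∑ a, πstar s a = 1 := fun s => by
    simp only [hπstar]
    rw [Finset.sum_comm]
    simp only [← Finset.mul_sum, hπksum, mul_one, hρsum]
  have facts := fun s a =>
    have := hRprob s a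
    (inner_facts (pR s a) Rmax (hRbdd s a) (q s a) (σ2 s a) (hq s a) (hσ2 s a) 0 0).1
  have hker : ∀ (φ : ℝ → ℝ), Measurable φ → ∀ a, Measurable fun s => ∫ r, φ r ∂pR s a := by
    intro φ hφ a
    let κ : Kernel S ℝ := ⟨fun s => pR s a, hRmeas.comp (measurable_id.prodMk measurable_const)⟩
    have : IsMarkovKernel κ := ⟨fun s => hRprob s a⟩
    exact (hφ.stronglyMeasurable.integral_kernel (κ := κ)).measurable
  have hqm : ∀ a, Measurable fun s => q s a := fun a => by
    simp only [hq]; exact hker _ measurable_id a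
  have hσm : ∀ a, Measurable fun s => σ2 s a := fun a => by
    have : ∀ s, σ2 s a = ∫ r, r ^ 2 ∂pR s a - q s a ^ 2 := fun s => (facts s a).2.2.2.2.2
    simp only [this]
    exact (hker _ (measurable_id.pow_const 2) a).sub ((hqm a).pow_const 2)
  have hvm : Measurable v := by
    have : v = fun s => ∑ a, πe s a * q s a := funext hv
    rw [this]
    exact Finset.measurable_sum _ fun a _ => (hπemeas a).mul (hqm a)
  have hvb : ∀ s, |v s| ≤ Rmax := fun s => by
    rw [hv, abs_of_nonneg (Finset.sum_nonneg fun a _ => mul_nonneg (hπenn s a) (facts s a).2.1)]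
    calc ∑ a, πe s a * q s a ≤ ∑ a, πe s a * Rmax :=
          Finset.sum_le_sum fun a _ => mul_le_mul_of_nonneg_left (facts s a).2.2.1 (hπenn s a)
      _ = Rmax := by rw [← Finset.sum_mul, hπesum, one_mul]
  let W : S → A → ℝ := fun s a => h s a * πe s a
  have hWm : ∀ a, Measurable fun s => W s a := fun a => by
    simp only [W, hh]
    refine Measurable.mul ?_ (hπemeas a)
    exact Measurable.ite (measurableSet_lt measurable_const (hsm a)) (hsm a).inv measurable_const
  have hWalt : ∀ s a, (if πe s a = 0 then 0 else πe s a / πstar s a) = W s a := fun s a => by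
    simp only [W, hh]
    rcases (hπenn s a).eq_or_lt with h0 | h0
    · simp [← h0]
    · rw [if_neg h0.ne', if_pos (hov s a h0), div_eq_mul_inv, mul_comm]
  have hWb : ∀ s a, |W s a| ≤ δ⁻¹ := fun s a => by
    rw [← hWalt]
    rcases (hπenn s a).eq_or_lt with h0 | h0
    · simp [← h0, hδ.le]
    · have h1 : πe s a ≤ 1 := by
        rw [← hπesum s]
        exact Finset.single_le_sum (f := fun a => πe s a) (fun b _ => hπenn s b)
          (Finset.mem_univ a)
      have h2 := hπstarlb s a h0
      rw [if_neg h0.ne', abs_of_nonneg (div_nonneg h0.le (hsnn s a)), ← one_div]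
      exact div_le_div₀ zero_le_one h1 hδ h2
  let X : S × A × ℝ → ℝ := fun x => W x.1 x.2.1 * (x.2.2 - q x.1 x.2.1) + v x.1
  have hsingle := fun k => single_var pS pR hRprob hRmeas Rmax hRbdd (πk k) (hπkmeas k)
    (hπknn k) (hπksum k) q σ2 W v hq hσ2 hqm hσm hWm hvm δ⁻¹ hWb hvb
  have hprob : ∀ k, IsProbabilityMeasure (obsMeasure pS (πk k) pR) := fun k =>
    obs_prob pS pR hRprob hRmeas (πk k) (hπkmeas k) (hπknn k) (hπksum k)
  have hΓ' : ∀ ω, Γ ω = N⁻¹ * ∑ i, X (ω i) := by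
    intro ω
    rw [hΓ]
    congr 1
    refine Finset.sum_congr rfl fun i _ => ?_
    rw [← hv]
  rw [pi_var (fun i : (k : Fin K) × Fin (nk k) => obsMeasure pS (πk i.1) pR)
    (fun i => hprob i.1) X N⁻¹ (fun i => (hsingle i.1).1) Γ hΓ']
  have hG : ∀ s a, |W s a ^ 2 * σ2 s a| ≤ (δ⁻¹) ^ 2 * Rmax ^ 2 := fun s a => by
    obtain ⟨h0, h1, h2, h3, h4, -⟩ := facts s a
    rw [abs_mul, abs_pow, abs_of_nonneg h3]
    exact mul_le_mul (pow_le_pow_left₀ (abs_nonneg _) (hWb s a) 2) h4 h3 (by positivity)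
  have hGm : ∀ a, Measurable fun s => W s a ^ 2 * σ2 s a :=
    fun a => ((hWm a).pow_const 2).mul (hσm a)
  have hV : Vstar = ∫ s, ∑ a, πstar s a * (W s a ^ 2 * σ2 s a) ∂pS + variance v pS := by
    rw [hVstar]
    congr 1
    simp only [hWalt]
    have hm1 : Measurable (fun p : S × A => W p.1 p.2 ^ 2 * σ2 p.1 p.2) :=
      measurable_from_prod_countable_left hGm
    rw [obs_integral pS pR hRprob hRmeas πstar hsm hsnn hssum
      (fun x => W x.1 x.2.1 ^ 2 * σ2 x.1 x.2.1)
      (hm1.comp (measurable_fst.prodMk measurable_snd.fst)) _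
      (fun s a => ae_of_all _ fun r => hG s a)]
    simp
  have hmix : ∫ s, ∑ a, πstar s a * (W s a ^ 2 * σ2 s a) ∂pS =
      ∑ k, ρ k * ∫ s, ∑ a, πk k s a * (W s a ^ 2 * σ2 s a) ∂pS := by
    simp only [← integral_const_mul]
    rw [← integral_finsetSum]
    · congr 1; ext s
      simp only [hπstar, Finset.sum_mul, Finset.mul_sum]
      rw [Finset.sum_comm]
      simp only [mul_assoc]
    · intro k _
      exact (term_integrable pS (πk k) (hπkmeas k) (hπknn k) (hπksum k) _ hGm _ hG).const_mul _
  have hsumi : ∑ i : (k : Fin K) × Fin (nk k), variance X (obsMeasure pS (πk i.1) pR)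
      = N * Vstar := by
    rw [Fintype.sum_sigma, hV, hmix]
    have h1 : ∀ k, variance X (obsMeasure pS (πk k) pR) =
      ∫ s, ∑ a, πk k s a * (W s a ^ 2 * σ2 s a) ∂pS + variance v pS := fun k => (hsingle k).2
    have h2 : ∀ k, (nk k : ℝ) = N * ρ k := fun k => by
      rw [hρ]; field_simp
    simp only [h1, Finset.sum_const, Finset.card_univ, Fintype.card_fin, nsmul_eq_mul, h2]
    simp only [mul_add, Finset.sum_add_distrib, Finset.mul_sum, mul_assoc]
    rw [← Finset.mul_sum, ← Finset.mul_sum, ← Finset.sum_mul, hρsum, one_mul]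
  rw [hsumi]
  field_simp
end
end

section
/- Under weak overlap, for every bounded measurable h: [K]×S×A → ℝ satisfying the constraint (*) and every bounded measurable g: S×A → ℝ, the estimator Γ(D;h,g) is unbiased: E[Γ(D;h,g)] = J, where J = E_{p_S}[q(s,π^e)]. -/
open MeasureTheory ProbabilityTheory BigOperators Filter
open scoped NNReal ENNReal

noncomputable section

section Helpers

variable {S A : Type*} [MeasurableSpace S] [MeasurableSpace A] [Fintype A]
    [MeasurableSingletonClass A]

lemma obsK_meas (π : S → A → ℝ) (hπ : ∀ a, Measurable fun s => π s a)
    (pR : S → A → Measure ℝ) (hRprob : ∀ s a, IsProbabilityMeasure (pR s a))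
    (hRmeas : Measurable fun p : S × A => pR p.1 p.2) :
    Measurable fun s => ∑ a : A, ENNReal.ofReal (π s a) • (pR s a).map (fun r => (s, a, r)) := by
  refine Measure.measurable_of_measurable_coe _ fun t ht => ?_
  simp only [Measure.finsetSum_apply, Measure.smul_apply, smul_eq_mul]
  refine Finset.measurable_sum _ fun a _ => ?_
  refine (hπ a).ennreal_ofReal.mul ?_
  have hκm : Measurable fun s => pR s a := hRmeas.comp (measurable_id.prodMk measurable_const)
  let κ : Kernel S ℝ := ⟨fun s => pR s a, hκm⟩
  haveI : IsMarkovKernel κ := ⟨fun s => hRprob s a⟩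
  have hm : Measurable fun p : S × ℝ => (p.1, a, p.2) := by fun_prop
  have := Kernel.measurable_kernel_prodMk_left (κ := κ) (hm ht)
  convert this using 2 with s
  rw [Measure.map_apply (by fun_prop) ht]
  rfl

lemma obs_main (pS : Measure S) [IsProbabilityMeasure pS]
    (π : S → A → ℝ) (hπ : ∀ a, Measurable fun s => π s a)
    (hπnn : ∀ s a, 0 ≤ π s a) (hπsum : ∀ s, ∑ a, π s a = 1)
    (pR : S → A → Measure ℝ) (hRprob : ∀ s a, IsProbabilityMeasure (pR s a))
    (hRmeas : Measurable fun p : S × A => pR p.1 p.2)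
    (f : S × A × ℝ → ℝ) (hf : Measurable f) (C : ℝ)
    (hC : ∀ s a, ∀ᵐ r ∂ pR s a, |f (s, a, r)| ≤ C) :
    IsProbabilityMeasure (obsMeasure pS π pR) ∧ Integrable f (obsMeasure pS π pR) ∧
    ∫ p, f p ∂(obsMeasure pS π pR) = ∫ s, ∑ a, π s a * ∫ r, f (s, a, r) ∂(pR s a) ∂pS := by
  let κ : Kernel S (S × A × ℝ) := ⟨_, obsK_meas π hπ pR hRprob hRmeas⟩
  have hκ : ∀ s, κ s = ∑ a : A, ENNReal.ofReal (π s a) • (pR s a).map (fun r => (s, a, r)) :=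
    fun s => rfl
  have hmap : ∀ (s : S) (a : A), Measurable (fun r : ℝ => (s, a, r)) := fun s a => by fun_prop
  haveI : IsMarkovKernel κ := by
    refine ⟨fun s => ⟨?_⟩⟩
    rw [hκ]
    simp only [Measure.finsetSum_apply, Measure.smul_apply, smul_eq_mul]
    have : ∀ a, ((pR s a).map (fun r => (s, a, r))) Set.univ = 1 := fun a => by
      rw [Measure.map_apply (hmap s a) MeasurableSet.univ]
      simp
    simp only [this, mul_one]
    rw [← ENNReal.ofReal_sum_of_nonneg (fun a _ => hπnn s a), hπsum, ENNReal.ofReal_one]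
  have hobs : obsMeasure pS π pR = κ ∘ₘ pS := rfl
  rw [hobs]
  have hset : MeasurableSet {p | |f p| ≤ C} := measurableSet_le hf.abs measurable_const
  have hbd : ∀ᵐ p ∂(κ ∘ₘ pS), ‖f p‖ ≤ C := by
    refine Measure.ae_comp_of_ae_ae hset (ae_of_all _ fun s => ?_)
    rw [hκ, ae_iff]
    simp only [Measure.finsetSum_apply, Measure.smul_apply, smul_eq_mul]
    refine Finset.sum_eq_zero fun a _ => ?_
    have h2 : ∀ᵐ p ∂((pR s a).map (fun r => (s, a, r))), |f p| ≤ C := by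
      rw [ae_map_iff (hmap s a).aemeasurable hset]
      exact hC s a
    rw [ae_iff] at h2
    simp only [Real.norm_eq_abs, h2, mul_zero]
  have hint : Integrable f (κ ∘ₘ pS) := Integrable.of_bound hf.aestronglyMeasurable C hbd
  refine ⟨inferInstance, hint, ?_⟩
  rw [Measure.comp_eq_comp_const_apply] at hint ⊢
  rw [Kernel.integral_comp hint]
  simp only [Kernel.const_apply]
  refine integral_congr_ae (ae_of_all _ fun s => ?_)
  simp only
  have hi : ∀ a, Integrable f ((pR s a).map (fun r => (s, a, r))) := fun a => by
    rw [integrable_map_measure hf.aestronglyMeasurable (hmap s a).aemeasurable]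
    exact Integrable.of_bound (hf.comp (hmap s a)).aestronglyMeasurable C (hC s a)
  rw [hκ, integral_finsetSum_measure (fun a _ => (hi a).smul_measure ENNReal.ofReal_ne_top)]
  refine Finset.sum_congr rfl fun a _ => ?_
  rw [integral_smul_measure, integral_map (hmap s a).aemeasurable hf.aestronglyMeasurable,
    ENNReal.toReal_ofReal (hπnn s a), smul_eq_mul]

end Helpers

/-- Under weak overlap, for every bounded measurable weight function
`h : [K]×S×A → ℝ` satisfying the constraint
`∑ k, ρ k * π_k(a|s) * h(k,s,a) = 1` whenever `π^e(a|s) > 0`, and every bounded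
measurable control variate `g`, the estimator `Γ(D;h,g)` is unbiased:
`E[Γ(D;h,g)] = J`, where `J = E_{p_S}[q(s,π^e)]`. -/
theorem stmt3 {S A : Type*} [MeasurableSpace S] [MeasurableSpace A] [Fintype A]
    [MeasurableSingletonClass A]
    (K : ℕ) (pS : Measure S) [IsProbabilityMeasure pS]
    (pR : S → A → Measure ℝ) (hRprob : ∀ s a, IsProbabilityMeasure (pR s a))
    (hRmeas : Measurable fun p : S × A => pR p.1 p.2)
    (Rmax : ℝ) (hRbdd : ∀ s a, ∀ᵐ r ∂ pR s a, r ∈ Set.Icc (0 : ℝ) Rmax)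
    (πk : Fin K → S → A → ℝ) (πe : S → A → ℝ)
    (hπkmeas : ∀ k a, Measurable fun s => πk k s a)
    (hπemeas : ∀ a, Measurable fun s => πe s a)
    (hπknn : ∀ k s a, 0 ≤ πk k s a) (hπksum : ∀ k s, ∑ a, πk k s a = 1)
    (hπenn : ∀ s a, 0 ≤ πe s a) (hπesum : ∀ s, ∑ a, πe s a = 1)
    -- stratum sizes and proportions
    (nk : Fin K → ℕ) (hn : 0 < ∑ k, nk k)
    (ρ : Fin K → ℝ) (hρ : ∀ k, ρ k = (nk k : ℝ) / (∑ k, nk k : ℕ))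
    -- marginal logging policy
    (πstar : S → A → ℝ) (hπstar : ∀ s a, πstar s a = ∑ k, ρ k * πk k s a)
    -- weak overlap
    (hov : ∀ s a, 0 < πe s a → 0 < πstar s a)
    -- true mean reward and policy value
    (q : S → A → ℝ) (hq : ∀ s a, q s a = ∫ r, r ∂ pR s a)
    (J : ℝ) (hJ : J = ∫ s, ∑ a, πe s a * q s a ∂ pS)
    -- bounded measurable weights satisfying the constraint (*)
    (h : Fin K → S → A → ℝ)
    (hhmeas : ∀ k, Measurable fun p : S × A => h k p.1 p.2)
    (Bh : ℝ) (hhbdd : ∀ k s a, |h k s a| ≤ Bh)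
    (hcon : ∀ s a, 0 < πe s a → ∑ k, ρ k * πk k s a * h k s a = 1)
    -- bounded measurable control variate
    (g : S → A → ℝ) (hgmeas : Measurable fun p : S × A => g p.1 p.2)
    (Bg : ℝ) (hgbdd : ∀ s a, |g s a| ≤ Bg)
    -- the estimator `Γ(D; h, g)`
    (Γ : (((k : Fin K) × Fin (nk k)) → S × A × ℝ) → ℝ)
    (hΓ : ∀ ω, Γ ω =
      ((∑ k, nk k : ℕ) : ℝ)⁻¹ * ∑ i : (k : Fin K) × Fin (nk k),
        (h i.1 (ω i).1 (ω i).2.1 * πe (ω i).1 (ω i).2.1 *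
            ((ω i).2.2 - g (ω i).1 (ω i).2.1) +
          ∑ a, πe (ω i).1 a * g (ω i).1 a)) :
    (∫ ω, Γ ω
      ∂ Measure.pi (fun i : (k : Fin K) × Fin (nk k) => obsMeasure pS (πk i.1) pR)) = J := by
  have hN : ((∑ k, nk k : ℕ) : ℝ) ≠ 0 := by exact_mod_cast hn.ne'
  have hem : Measurable fun p : S × A => πe p.1 p.2 :=
    measurable_from_prod_countable_left fun a => hπemeas a
  have hg1 : ∀ a, Measurable fun s => g s a := fun a =>
    hgmeas.comp (measurable_id.prodMk measurable_const)
  have hh1 : ∀ k a, Measurable fun s => h k s a := fun k a =>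
    (hhmeas k).comp (measurable_id.prodMk measurable_const)
  have he1 : ∀ s a, πe s a ≤ 1 := fun s a => by
    rw [← hπesum s]
    exact Finset.single_le_sum (fun a _ => hπenn s a) (Finset.mem_univ a)
  have hk1 : ∀ k s a, πk k s a ≤ 1 := fun k s a => by
    rw [← hπksum k s]
    exact Finset.single_le_sum (fun a _ => hπknn k s a) (Finset.mem_univ a)
  let f : Fin K → S × A × ℝ → ℝ := fun k p =>
    h k p.1 p.2.1 * πe p.1 p.2.1 * (p.2.2 - g p.1 p.2.1) + ∑ a, πe p.1 a * g p.1 a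
  have hfm : ∀ k, Measurable (f k) := fun k => by
    have hp : Measurable fun p : S × A × ℝ => (p.1, p.2.1) := by fun_prop
    have e1 := (hhmeas k).comp hp
    have e2 := hem.comp hp
    have e3 := hgmeas.comp hp
    have e4 : Measurable fun p : S × A × ℝ => ∑ a, πe p.1 a * g p.1 a :=
      Finset.measurable_sum _ fun a _ =>
        ((hπemeas a).comp measurable_fst).mul ((hg1 a).comp measurable_fst)
    exact ((e1.mul e2).mul (measurable_snd.snd.sub e3)).add e4
  have hsb : ∀ s, |∑ a, πe s a * g s a| ≤ Bg := fun s => by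
    calc |∑ a, πe s a * g s a| ≤ ∑ a, |πe s a * g s a| := Finset.abs_sum_le_sum_abs _ _
      _ ≤ ∑ a, πe s a * Bg := Finset.sum_le_sum fun a _ => by
          rw [abs_mul, abs_of_nonneg (hπenn s a)]
          exact mul_le_mul_of_nonneg_left (hgbdd s a) (hπenn s a)
      _ = Bg := by rw [← Finset.sum_mul, hπesum, one_mul]
  have hfb : ∀ k s a, ∀ᵐ r ∂ pR s a, |f k (s, a, r)| ≤ Bh * 1 * (Rmax + Bg) + Bg := by
    intro k s a
    filter_upwards [hRbdd s a] with r hr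
    have hb0 : 0 ≤ Bh := (abs_nonneg _).trans (hhbdd k s a)
    refine (abs_add_le _ _).trans (add_le_add ?_ (hsb s))
    simp only [abs_mul]
    refine mul_le_mul (mul_le_mul (hhbdd k s a) ?_ (abs_nonneg _) hb0) ?_ (abs_nonneg _) (by positivity)
    · rw [abs_of_nonneg (hπenn s a)]; exact he1 s a
    · refine (abs_sub _ _).trans (add_le_add ?_ (hgbdd s a))
      rw [abs_of_nonneg hr.1]; exact hr.2
  have hrint : ∀ s a, Integrable (fun r : ℝ => r) (pR s a) := fun s a => by
    haveI := hRprob s a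
    refine Integrable.of_bound measurable_id.aestronglyMeasurable Rmax ?_
    filter_upwards [hRbdd s a] with r hr
    simp only [id, Real.norm_eq_abs]
    rw [abs_of_nonneg hr.1]; exact hr.2
  have hqm : ∀ a, Measurable fun s => q s a := fun a => by
    have hκm : Measurable fun s => pR s a := hRmeas.comp (measurable_id.prodMk measurable_const)
    let κ : Kernel S ℝ := ⟨fun s => pR s a, hκm⟩
    have hs : StronglyMeasurable fun r : ℝ => r := measurable_id.stronglyMeasurable
    have := (hs.integral_kernel (κ := κ)).measurable
    convert this using 2 with s
    exact hq s a
  have hqb : ∀ s a, |q s a| ≤ Rmax := fun s a => by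
    haveI := hRprob s a
    rw [hq]
    have := norm_integral_le_of_norm_le_const (μ := pR s a) (f := fun r : ℝ => r) (C := Rmax) (by
      filter_upwards [hRbdd s a] with r hr
      rw [Real.norm_eq_abs, abs_of_nonneg hr.1]; exact hr.2)
    simpa using this
  have hmain := fun k => obs_main pS (πk k) (hπkmeas k) (hπknn k) (hπksum k) pR hRprob hRmeas
    (f k) (hfm k) _ (hfb k)
  haveI : ∀ i : (k : Fin K) × Fin (nk k), IsProbabilityMeasure (obsMeasure pS (πk i.1) pR) :=
    fun i => (hmain i.1).1
  -- inner integral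
  let F : Fin K → S → ℝ := fun k s =>
    ∑ a, πk k s a * h k s a * πe s a * (q s a - g s a) + ∑ a, πe s a * g s a
  have hinner : ∀ k s, ∑ a, πk k s a * ∫ r, f k (s, a, r) ∂(pR s a) = F k s := by
    intro k s
    have : ∀ a, ∫ r, f k (s, a, r) ∂(pR s a)
        = h k s a * πe s a * (q s a - g s a) + ∑ a, πe s a * g s a := fun a => by
      haveI := hRprob s a
      simp only [f]
      have hsub : Integrable (fun r : ℝ => r - g s a) (pR s a) :=
        (hrint s a).sub (integrable_const _)
      rw [integral_add (hsub.const_mul _) (integrable_const _),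
        integral_const_mul, integral_sub (hrint s a) (integrable_const _), ← hq]
      simp
    simp only [this, mul_add, Finset.sum_add_distrib, F]
    rw [← Finset.sum_mul, hπksum, one_mul]
    simp only [mul_assoc]
  have hFint : ∀ k, Integrable (F k) pS := fun k => by
    refine Integrable.add ?_ ?_
    · refine integrable_finsetSum _ fun a _ => ?_
      refine Integrable.of_bound (C := 1 * Bh * 1 * (Rmax + Bg))
        (((((hπkmeas k a).mul (hh1 k a)).mul (hπemeas a)).mul
          ((hqm a).sub (hg1 a))).aestronglyMeasurable) (ae_of_all _ fun s => ?_)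
      have hb0 : 0 ≤ Bh := (abs_nonneg _).trans (hhbdd k s a)
      simp only [Real.norm_eq_abs, abs_mul, abs_of_nonneg (hπenn s a), abs_of_nonneg (hπknn k s a)]
      have e1 := hk1 k s a
      have e2 := hhbdd k s a
      have e3 := he1 s a
      have e4 : |q s a - g s a| ≤ Rmax + Bg :=
        (abs_sub _ _).trans (add_le_add (hqb s a) (hgbdd s a))
      have e5 := hπenn s a
      gcongr
    · refine integrable_finsetSum _ fun a _ => ?_
      refine Integrable.of_bound (C := 1 * Bg)
        (((hπemeas a).mul (hg1 a)).aestronglyMeasurable) (ae_of_all _ fun s => ?_)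
      simp only [Real.norm_eq_abs, abs_mul, abs_of_nonneg (hπenn s a)]
      have e3 := he1 s a
      have e2 := hgbdd s a
      gcongr
  have hρsum : ∑ k, ρ k = 1 := by
    simp only [hρ]
    rw [← Finset.sum_div, ← Nat.cast_sum, div_self hN]
  have hpt : ∀ s, ∑ k, ρ k * F k s = ∑ a, πe s a * q s a := by
    intro s
    simp only [F, mul_add, Finset.sum_add_distrib]
    rw [← Finset.sum_mul, hρsum, one_mul]
    simp only [Finset.mul_sum]
    rw [Finset.sum_comm, ← Finset.sum_add_distrib]
    refine Finset.sum_congr rfl fun a _ => ?_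
    rcases (hπenn s a).eq_or_lt with h0 | h0
    · simp [← h0]
    · have hc := hcon s a h0
      have : ∑ k, ρ k * (πk k s a * h k s a * πe s a * (q s a - g s a))
          = (∑ k, ρ k * πk k s a * h k s a) * (πe s a * (q s a - g s a)) := by
        rw [Finset.sum_mul]
        exact Finset.sum_congr rfl fun k _ => by ring
      rw [this, hc]
      ring
  have hΓ' : Γ = fun ω => ((∑ k, nk k : ℕ) : ℝ)⁻¹ *
      ∑ i : (k : Fin K) × Fin (nk k), f i.1 (ω i) := funext hΓ
  rw [hΓ', integral_const_mul, integral_finsetSum _ (fun i _ =>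
    integrable_comp_eval (μ := fun i : (k : Fin K) × Fin (nk k) =>
      obsMeasure pS (πk i.1) pR) (i := i) (f := f i.1) (hmain i.1).2.1)]
  have hev : ∀ i : (k : Fin K) × Fin (nk k),
      ∫ ω, f i.1 (ω i) ∂ Measure.pi (fun i : (k : Fin K) × Fin (nk k) =>
        obsMeasure pS (πk i.1) pR) = ∫ s, F i.1 s ∂pS := fun i => by
    rw [integral_comp_eval (μ := fun i : (k : Fin K) × Fin (nk k) =>
        obsMeasure pS (πk i.1) pR) (i := i) (f := f i.1) (hfm i.1).aestronglyMeasurable,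
      (hmain i.1).2.2]
    simp only [hinner]
  simp only [hev]
  rw [Fintype.sum_sigma, hJ]
  simp only [Finset.sum_const, Finset.card_univ, Fintype.card_fin, nsmul_eq_mul]
  simp only [← hpt]
  rw [integral_finsetSum _ (fun k _ => (hFint k).const_mul _), Finset.mul_sum]
  refine Finset.sum_congr rfl fun k _ => ?_
  rw [integral_const_mul, hρ]
  ring
end
end
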